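/- Convexity of the constants: for any fixed prime p and integer k ≥ 1, each of the maps δ ↦ c_IP^rec(k,δ,F_p^ω), δ ↦ c_IP(k,δ,F_p^ω), δ ↦ c^rec(k,δ,F_p^ω), and δ ↦ c(k,δ,F_p^ω) is a convex function on [0,1]. -/

import Mathlib

open MeasureTheory Filter Topology
open scoped symmDiff Classical

noncomputable section

/-- A Følner sequence in an abelian group: a sequence of nonempty finite subsets that is
asymptotically invariant under translations. -/
def IsFolner {Γ : Type*} [AddCommGroup Γ] (Φ : ℕ → Finset Γ) : Prop :=
  (∀ N, (Φ N).Nonempty) ∧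
    ∀ a : Γ,
      Tendsto (fun N => ((((Φ N).image (· + a)) ∆ (Φ N)).card : ℝ) / ((Φ N).card : ℝ))
        atTop (nhds 0)

/-- Upper density of a set `E ⊆ Γ` along a Følner sequence `Φ`. -/
def upperDensity {Γ : Type*} [AddCommGroup Γ] (Φ : ℕ → Finset Γ) (E : Set Γ) : ℝ :=
  Filter.limsup
    (fun N => (((Φ N).filter (fun x => x ∈ E)).card : ℝ) / ((Φ N).card : ℝ)) atTop

/-- A `Γ`-system: a compact metric space with its Borel σ-algebra, a (automatically regular)
Borel probability measure, and a measure-preserving action of `Γ`. -/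
structure GSystem (Γ : Type*) [AddCommGroup Γ] where
  X : Type
  met : MetricSpace X
  cpt : CompactSpace X
  mble : MeasurableSpace X
  borelSpace : BorelSpace X
  μ : Measure X
  prob : IsProbabilityMeasure μ
  T : Γ → X → X
  T_zero : T 0 = id
  T_add : ∀ γ γ' : Γ, T (γ + γ') = T γ ∘ T γ'
  measurePreserving : ∀ γ : Γ, MeasurePreserving (T γ) μ μ

attribute [instance] GSystem.met GSystem.cpt GSystem.mble GSystem.borelSpace GSystem.prob

/-- The set `E ∩ (E - γ) ∩ ⋯ ∩ (E - (k-1)γ)`. -/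
def progPreimage {Γ : Type*} [AddCommGroup Γ] (E : Set Γ) (k : ℕ) (γ : Γ) : Set Γ :=
  ⋂ i ∈ Finset.range k, (fun x => x + i • γ) ⁻¹' E

/-- The set `A ∩ T^{-γ}A ∩ ⋯ ∩ T^{-(k-1)γ}A`. -/
def recIntersection {Γ : Type*} [AddCommGroup Γ] (S : GSystem Γ) (A : Set S.X) (k : ℕ)
    (γ : Γ) : Set S.X :=
  ⋂ i ∈ Finset.range k, S.T (i • γ) ⁻¹' A

/-- The Furstenberg constant `c(k, δ, Γ)`. -/
def cF (Γ : Type*) [AddCommGroup Γ] (k : ℕ) (δ : ℝ) : ℝ :=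
  sInf {r : ℝ | ∃ Φ : ℕ → Finset Γ, IsFolner Φ ∧ ∃ E : Set Γ, δ ≤ upperDensity Φ E ∧
    r = sSup {s : ℝ | ∃ γ : Γ, γ ≠ 0 ∧ s = upperDensity Φ (progPreimage E k γ)}}

/-- The Furstenberg–Katznelson constant `c_IP(k, δ, Γ)`. -/
def cIP (Γ : Type*) [AddCommGroup Γ] (k : ℕ) (δ : ℝ) : ℝ :=
  sInf {r : ℝ | ∃ Φ : ℕ → Finset Γ, IsFolner Φ ∧ ∃ E : Set Γ, δ ≤ upperDensity Φ E ∧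
    ∃ γseq : ℕ → Γ,
      r = sSup {s : ℝ | ∃ F : Finset ℕ, F.Nonempty ∧
        s = upperDensity Φ (progPreimage E k (∑ n ∈ F, γseq n))}}

/-- The recurrence constant `c^rec(k, δ, Γ)`. -/
def cRec (Γ : Type*) [AddCommGroup Γ] (k : ℕ) (δ : ℝ) : ℝ :=
  sInf {r : ℝ | ∃ (S : GSystem Γ) (A : Set S.X), MeasurableSet A ∧ δ ≤ (S.μ A).toReal ∧
    r = sSup {s : ℝ | ∃ γ : Γ, γ ≠ 0 ∧ s = (S.μ (recIntersection S A k γ)).toReal}}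

/-- The IP recurrence constant `c_IP^rec(k, δ, Γ)`. -/
def cIPRec (Γ : Type*) [AddCommGroup Γ] (k : ℕ) (δ : ℝ) : ℝ :=
  sInf {r : ℝ | ∃ (S : GSystem Γ) (A : Set S.X), MeasurableSet A ∧ δ ≤ (S.μ A).toReal ∧
    ∃ γseq : ℕ → Γ,
      r = sSup {s : ℝ | ∃ F : Finset ℕ, F.Nonempty ∧
        s = (S.μ (recIntersection S A k (∑ n ∈ F, γseq n))).toReal}}

/-- `F_p^ω`, the countable direct sum of copies of `ZMod p`. -/
abbrev Fpω (p : ℕ) : Type := ℕ →₀ ZMod p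



/-! ### Convexity of infima over families closed under mixing -/

lemma convexOn_sInf_of_mixing {ι : Type*} (d c : ι → ℝ) (hc : ∀ i, 0 ≤ c i)
    (hone : ∃ i, 1 ≤ d i)
    (hmix : ∀ i j, ∀ a b : ℝ, 0 ≤ a → 0 ≤ b → a + b = 1 →
      ∃ l, a * d i + b * d j ≤ d l ∧ c l ≤ a * c i + b * c j) :
    ConvexOn ℝ (Set.Icc (0 : ℝ) 1) (fun δ => sInf {r : ℝ | ∃ i, δ ≤ d i ∧ r = c i}) := by
  have hbdd : ∀ δ, BddBelow {r : ℝ | ∃ i, δ ≤ d i ∧ r = c i} := by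
    rintro δ
    refine ⟨0, ?_⟩
    rintro r ⟨i, -, rfl⟩
    exact hc i
  have hne : ∀ δ ≤ (1 : ℝ), {r : ℝ | ∃ i, δ ≤ d i ∧ r = c i}.Nonempty := by
    intro δ hδ
    obtain ⟨i, hi⟩ := hone
    exact ⟨c i, i, hδ.trans hi, rfl⟩
  refine ⟨convex_Icc 0 1, ?_⟩
  intro x hx y hy a b ha hb hab
  refine le_of_forall_pos_le_add fun ε hε => ?_
  obtain ⟨_, ⟨i, hi, rfl⟩, hri⟩ := exists_lt_of_csInf_lt (hne x hx.2)
    (lt_add_of_pos_right (sInf {r : ℝ | ∃ i, x ≤ d i ∧ r = c i}) hε)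
  obtain ⟨_, ⟨j, hj, rfl⟩, hrj⟩ := exists_lt_of_csInf_lt (hne y hy.2)
    (lt_add_of_pos_right (sInf {r : ℝ | ∃ i, y ≤ d i ∧ r = c i}) hε)
  obtain ⟨l, hdl, hcl⟩ := hmix i j a b ha hb hab
  have hmem : c l ∈ {r : ℝ | ∃ i, a • x + b • y ≤ d i ∧ r = c i} := by
    refine ⟨l, le_trans ?_ hdl, rfl⟩
    simp only [smul_eq_mul]
    gcongr
  calc sInf {r : ℝ | ∃ i, a • x + b • y ≤ d i ∧ r = c i} ≤ c l := csInf_le (hbdd _) hmem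
    _ ≤ a * c i + b * c j := hcl
    _ ≤ a * (sInf {r : ℝ | ∃ i, x ≤ d i ∧ r = c i} + ε)
        + b * (sInf {r : ℝ | ∃ i, y ≤ d i ∧ r = c i} + ε) := by gcongr
    _ = _ := by simp only [smul_eq_mul]; linear_combination ε * hab

/-- A family of profiles, consisting of a density `d i` and return densities `s i γ`, is closed
under mixing along endomorphisms if any convex combination of two pulled back profiles is dominated
by a profile of the family of at least the combined density. -/
def ClosedUnderMixing {Γ : Type*} [AddCommGroup Γ] {ι : Type*} (d : ι → ℝ) (s : ι → Γ → ℝ) :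
    Prop :=
  ∀ i j (φ ψ : Γ →+ Γ) (a b : ℝ), 0 ≤ a → 0 ≤ b → a + b = 1 →
    ∃ l, a * d i + b * d j ≤ d l ∧ ∀ γ, s l γ ≤ a * s i (φ γ) + b * s j (ψ γ)

section Profiles

variable {Γ : Type*} [AddCommGroup Γ] {ι : Type*} {d : ι → ℝ} {s : ι → Γ → ℝ}

lemma ClosedUnderMixing.convexOn_sInf_sSup (hmix : ClosedUnderMixing d s)
    (hs0 : ∀ i γ, 0 ≤ s i γ) (hs1 : ∀ i γ, s i γ ≤ 1) (hone : ∃ i, 1 ≤ d i) :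
    ConvexOn ℝ (Set.Icc (0 : ℝ) 1) (fun δ => sInf {r : ℝ | ∃ i, δ ≤ d i ∧
      r = sSup {x : ℝ | ∃ γ : Γ, γ ≠ 0 ∧ x = s i γ}}) := by
  have hnonneg : ∀ i, 0 ≤ sSup {x : ℝ | ∃ γ : Γ, γ ≠ 0 ∧ x = s i γ} := by
    refine fun i => Real.sSup_nonneg ?_
    rintro x ⟨γ, -, rfl⟩
    exact hs0 i γ
  have hle : ∀ i γ, γ ≠ 0 → s i γ ≤ sSup {x : ℝ | ∃ γ : Γ, γ ≠ 0 ∧ x = s i γ} := by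
    intro i γ hγ
    refine le_csSup ⟨1, ?_⟩ ⟨γ, hγ, rfl⟩
    rintro x ⟨γ, -, rfl⟩
    exact hs1 i γ
  refine convexOn_sInf_of_mixing d _ hnonneg hone fun i j a b ha hb hab => ?_
  obtain ⟨l, hdl, hsl⟩ := hmix i j (AddMonoidHom.id Γ) (AddMonoidHom.id Γ) a b ha hb hab
  refine ⟨l, hdl, Real.sSup_le ?_ ?_⟩
  · rintro x ⟨γ, hγ, rfl⟩
    refine (hsl γ).trans ?_
    have h₁ := hle i γ hγ
    have h₂ := hle j γ hγ
    simp only [AddMonoidHom.id_apply]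
    gcongr
  · have h₁ := hnonneg i
    have h₂ := hnonneg j
    positivity

/-- In a group with a free sequence `e`, two IP sets can be replaced by the single one generated
by `e`, by pulling back along endomorphisms. -/
lemma ClosedUnderMixing.convexOn_sInf_sSup_IP (hmix : ClosedUnderMixing d s)
    (hs0 : ∀ i γ, 0 ≤ s i γ) (hs1 : ∀ i γ, s i γ ≤ 1) (hone : ∃ i, 1 ≤ d i) (e : ℕ → Γ)
    (he : ∀ γseq : ℕ → Γ, ∃ φ : Γ →+ Γ, ∀ n, φ (e n) = γseq n) :
    ConvexOn ℝ (Set.Icc (0 : ℝ) 1) (fun δ => sInf {r : ℝ | ∃ q : ι × (ℕ → Γ), δ ≤ d q.1 ∧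
      r = sSup {x : ℝ | ∃ F : Finset ℕ, F.Nonempty ∧ x = s q.1 (∑ n ∈ F, q.2 n)}}) := by
  have hnonneg : ∀ q : ι × (ℕ → Γ),
      0 ≤ sSup {x : ℝ | ∃ F : Finset ℕ, F.Nonempty ∧ x = s q.1 (∑ n ∈ F, q.2 n)} := by
    refine fun q => Real.sSup_nonneg ?_
    rintro x ⟨F, -, rfl⟩
    exact hs0 _ _
  have hle : ∀ (q : ι × (ℕ → Γ)) (F : Finset ℕ), F.Nonempty → s q.1 (∑ n ∈ F, q.2 n) ≤
      sSup {x : ℝ | ∃ F : Finset ℕ, F.Nonempty ∧ x = s q.1 (∑ n ∈ F, q.2 n)} := by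
    intro q F hF
    refine le_csSup ⟨1, ?_⟩ ⟨F, hF, rfl⟩
    rintro x ⟨F, -, rfl⟩
    exact hs1 _ _
  refine convexOn_sInf_of_mixing (fun q : ι × (ℕ → Γ) => d q.1) _ hnonneg
    (hone.imp' (fun i => (i, 0)) fun _ h => h) fun q q' a b ha hb hab => ?_
  obtain ⟨φ, hφ⟩ := he q.2
  obtain ⟨ψ, hψ⟩ := he q'.2
  obtain ⟨l, hdl, hsl⟩ := hmix q.1 q'.1 φ ψ a b ha hb hab
  refine ⟨(l, e), hdl, Real.sSup_le ?_ ?_⟩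
  · rintro x ⟨F, hF, rfl⟩
    refine (hsl _).trans ?_
    have h₁ := hle q F hF
    have h₂ := hle q' F hF
    simp only [map_sum, hφ, hψ]
    gcongr
  · have h₁ := hnonneg q
    have h₂ := hnonneg q'
    positivity

end Profiles

/-! ### Mixing systems -/

section Systems

lemma borelSpace_sum (X Y : Type*) [MetricSpace X] [MetricSpace Y] [MeasurableSpace X]
    [MeasurableSpace Y] [BorelSpace X] [BorelSpace Y] : BorelSpace (X ⊕ Y) := by
  refine ⟨le_antisymm (fun s hs => ?_) (MeasurableSpace.generateFrom_le fun s hs => ?_)⟩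
  · borelize (X ⊕ Y)
    rw [← Set.image_preimage_inl_union_image_preimage_inr s]
    exact (Topology.IsOpenEmbedding.inl.measurableEmbedding.measurableSet_image.2 hs.1).union
      (Topology.IsOpenEmbedding.inr.measurableEmbedding.measurableSet_image.2 hs.2)
  · have h := isOpen_sum_iff.1 hs
    exact ⟨h.1.measurableSet, h.2.measurableSet⟩

variable {Γ : Type*} [AddCommGroup Γ]

/-- The disjoint union of the pullbacks of two systems along endomorphisms, with weights `a`
and `b`. -/
def GSystem.mix (S S' : GSystem Γ) (φ ψ : Γ →+ Γ) (a b : ℝ) (ha : 0 ≤ a) (hb : 0 ≤ b)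
    (hab : a + b = 1) : GSystem Γ where
  X := S.X ⊕ S'.X
  met := Metric.metricSpaceSum
  cpt := inferInstanceAs (CompactSpace (S.X ⊕ S'.X))
  mble := inferInstance
  borelSpace := borelSpace_sum S.X S'.X
  μ := ENNReal.ofReal a • S.μ.map Sum.inl + ENNReal.ofReal b • S'.μ.map Sum.inr
  prob := ⟨by
    rw [Measure.add_apply, Measure.smul_apply, Measure.smul_apply,
      Measure.map_apply measurable_inl .univ, Measure.map_apply measurable_inr .univ]
    simp [← ENNReal.ofReal_add ha hb, hab]⟩
  T γ := Sum.map (S.T (φ γ)) (S'.T (ψ γ))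
  T_zero := by simp [S.T_zero, S'.T_zero]
  T_add γ γ' := by simp [S.T_add, S'.T_add, Sum.map_comp_map]
  measurePreserving γ := by
    have h₁ := S.measurePreserving (φ γ)
    have h₂ := S'.measurePreserving (ψ γ)
    have hm : Measurable (Sum.map (S.T (φ γ)) (S'.T (ψ γ))) :=
      h₁.measurable.sumMap h₂.measurable
    refine ⟨hm, ?_⟩
    rw [Measure.map_add _ _ hm, Measure.map_smul, Measure.map_smul,
      Measure.map_map hm measurable_inl, Measure.map_map hm measurable_inr,
      show Sum.map (S.T (φ γ)) (S'.T (ψ γ)) ∘ Sum.inl = Sum.inl ∘ S.T (φ γ) from rfl,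
      show Sum.map (S.T (φ γ)) (S'.T (ψ γ)) ∘ Sum.inr = Sum.inr ∘ S'.T (ψ γ) from rfl,
      ← Measure.map_map measurable_inl h₁.measurable,
      ← Measure.map_map measurable_inr h₂.measurable, h₁.map_eq, h₂.map_eq]

lemma GSystem.mix_apply (S S' : GSystem Γ) (φ ψ : Γ →+ Γ) (a b : ℝ) (ha : 0 ≤ a) (hb : 0 ≤ b)
    (hab : a + b = 1) {B : Set (S.X ⊕ S'.X)} (hB : MeasurableSet B) :
    ((S.mix S' φ ψ a b ha hb hab).μ B).toReal =
      a * (S.μ (Sum.inl ⁻¹' B)).toReal + b * (S'.μ (Sum.inr ⁻¹' B)).toReal := by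
  change ((ENNReal.ofReal a • S.μ.map Sum.inl + ENNReal.ofReal b • S'.μ.map Sum.inr :
    Measure (S.X ⊕ S'.X)) B).toReal = _
  rw [Measure.add_apply, Measure.smul_apply, Measure.smul_apply,
    Measure.map_apply measurable_inl hB, Measure.map_apply measurable_inr hB]
  simp only [smul_eq_mul]
  rw [ENNReal.toReal_add (by finiteness) (by finiteness)]
  simp [ENNReal.toReal_ofReal, ha, hb]

lemma mem_recIntersection {S : GSystem Γ} {A : Set S.X} {k : ℕ} {γ : Γ} {x : S.X} :
    x ∈ recIntersection S A k γ ↔ ∀ i < k, S.T (i • γ) x ∈ A := by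
  simp [recIntersection]

lemma measurableSet_recIntersection (S : GSystem Γ) {A : Set S.X} (hA : MeasurableSet A) (k : ℕ)
    (γ : Γ) : MeasurableSet (recIntersection S A k γ) :=
  Finset.measurableSet_biInter _ fun i _ => (S.measurePreserving (i • γ)).measurable hA

lemma closedUnderMixing_rec (k : ℕ) :
    ClosedUnderMixing
      (fun q : (Σ S : GSystem Γ, {A : Set S.X // MeasurableSet A}) => (q.1.μ q.2.1).toReal)
      (fun q γ => (q.1.μ (recIntersection q.1 q.2.1 k γ)).toReal) := by
  rintro ⟨S, A, hA⟩ ⟨S', A', hA'⟩ φ ψ a b ha hb hab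
  let C : Set (S.X ⊕ S'.X) := {z | Sum.elim (· ∈ A) (· ∈ A') z}
  have hC : MeasurableSet C := ⟨hA, hA'⟩
  refine ⟨⟨S.mix S' φ ψ a b ha hb hab, C, hC⟩, ?_, fun γ => ?_⟩
  · exact (S.mix_apply S' φ ψ a b ha hb hab hC).ge
  · refine ((S.mix_apply S' φ ψ a b ha hb hab
      (measurableSet_recIntersection (S.mix S' φ ψ a b ha hb hab) hC k γ)).trans ?_).le
    have h₁ : (Sum.inl : S.X → S.X ⊕ S'.X) ⁻¹'
        recIntersection (S.mix S' φ ψ a b ha hb hab) C k γ =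
          recIntersection S A k (φ γ) := by
      ext x
      refine mem_recIntersection.trans (Iff.trans ?_ mem_recIntersection.symm)
      simp only [← map_nsmul]
      rfl
    have h₂ : (Sum.inr : S'.X → S.X ⊕ S'.X) ⁻¹'
        recIntersection (S.mix S' φ ψ a b ha hb hab) C k γ =
          recIntersection S' A' k (ψ γ) := by
      ext x
      refine mem_recIntersection.trans (Iff.trans ?_ mem_recIntersection.symm)
      simp only [← map_nsmul]
      rfl
    rw [h₁, h₂]

variable (Γ) in
lemma nonempty_gSystem : Nonempty (GSystem Γ) :=
  ⟨{ X := Unit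
     met := inferInstance
     cpt := inferInstance
     mble := inferInstance
     borelSpace := inferInstance
     μ := Measure.dirac ()
     prob := inferInstance
     T := fun _ => id
     T_zero := rfl
     T_add := fun _ _ => rfl
     measurePreserving := fun _ => MeasurePreserving.id _ }⟩

end Systems

/-! ### Densities along Følner sequences -/

section Density

variable {Γ : Type*} [AddCommGroup Γ]

/-- The proportion of `Q` that lies in `E`. -/
def densityIn {α : Type*} (Q : Finset α) (E : Set α) : ℝ :=
  ((Q.filter (fun x => x ∈ E)).card : ℝ) / (Q.card : ℝ)

lemma densityIn_nonneg {α : Type*} (Q : Finset α) (E : Set α) : 0 ≤ densityIn Q E := by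
  unfold densityIn
  positivity

lemma densityIn_le_one {α : Type*} (Q : Finset α) (E : Set α) : densityIn Q E ≤ 1 :=
  div_le_one_of_le₀ (mod_cast Finset.card_filter_le _ _) (by positivity)

lemma densityIn_congr {α : Type*} {Q : Finset α} {E F : Set α} (h : ∀ x ∈ Q, x ∈ E ↔ x ∈ F) :
    densityIn Q E = densityIn Q F := by
  rw [densityIn, densityIn, Finset.filter_congr h]

lemma densityIn_image {α β : Type*} [DecidableEq β] {Q : Finset α} {f : α → β}
    (hf : Set.InjOn f Q) (E : Set β) : densityIn (Q.image f) E = densityIn Q (f ⁻¹' E) := by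
  rw [densityIn, densityIn, Finset.filter_image, Finset.card_image_of_injOn hf,
    Finset.card_image_of_injOn (hf.mono (Finset.coe_subset.2 (Finset.filter_subset _ _)))]
  rfl

lemma densityIn_univ {α : Type*} {Q : Finset α} (hQ : Q.Nonempty) :
    densityIn Q Set.univ = 1 := by
  have : (Q.card : ℝ) ≠ 0 := by exact_mod_cast hQ.card_pos.ne'
  simp [densityIn, this]

lemma isBoundedUnder_densityIn {α : Type*} (Φ : ℕ → Finset α) (E : Set α) :
    atTop.IsBoundedUnder (· ≤ ·) (fun N => densityIn (Φ N) E) :=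
  isBoundedUnder_of ⟨1, fun _ => densityIn_le_one _ _⟩

lemma isCoboundedUnder_densityIn {α : Type*} (Φ : ℕ → Finset α) (E : Set α) :
    atTop.IsCoboundedUnder (· ≤ ·) (fun N => densityIn (Φ N) E) :=
  (isBoundedUnder_of ⟨0, fun _ => densityIn_nonneg _ _⟩ :
    atTop.IsBoundedUnder (· ≥ ·) (fun N => densityIn (Φ N) E)).isCoboundedUnder_le

lemma le_upperDensity {Φ : ℕ → Finset Γ} {E : Set Γ} {l : ℕ → ℝ} {L : ℝ}
    (hl : Tendsto l atTop (𝓝 L)) (h : ∀ᶠ N in atTop, l N ≤ densityIn (Φ N) E) :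
    L ≤ upperDensity Φ E := by
  rw [← hl.limsup_eq]
  exact limsup_le_limsup h hl.isCoboundedUnder_le (isBoundedUnder_densityIn Φ E)

lemma upperDensity_le {Φ : ℕ → Finset Γ} {E : Set Γ} {u : ℕ → ℝ} {L : ℝ}
    (hu : Tendsto u atTop (𝓝 L)) (h : ∀ᶠ N in atTop, densityIn (Φ N) E ≤ u N) :
    upperDensity Φ E ≤ L := by
  rw [← hu.limsup_eq]
  exact limsup_le_limsup h (isCoboundedUnder_densityIn Φ E) hu.isBoundedUnder_le

lemma upperDensity_nonneg (Φ : ℕ → Finset Γ) (E : Set Γ) : 0 ≤ upperDensity Φ E :=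
  le_upperDensity tendsto_const_nhds (.of_forall fun _ => densityIn_nonneg _ _)

lemma upperDensity_le_one (Φ : ℕ → Finset Γ) (E : Set Γ) : upperDensity Φ E ≤ 1 :=
  upperDensity_le tendsto_const_nhds (.of_forall fun _ => densityIn_le_one _ _)

lemma isFolner_of_eventually_add_mem {Φ : ℕ → Finset Γ} (hne : ∀ N, (Φ N).Nonempty)
    (h : ∀ a, ∀ᶠ N in atTop, ∀ w ∈ Φ N, w + a ∈ Φ N) : IsFolner Φ := by
  refine ⟨hne, fun a => tendsto_const_nhds.congr' ?_⟩
  filter_upwards [h a] with N hN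
  have himage : (Φ N).image (· + a) = Φ N :=
    Finset.eq_of_subset_of_card_le (Finset.image_subset_iff.2 hN)
      (Finset.card_image_of_injective _ (add_left_injective a)).ge
  simp [himage]

lemma IsFolner.upperDensity_univ {Φ : ℕ → Finset Γ} (hΦ : IsFolner Φ) :
    1 ≤ upperDensity Φ Set.univ :=
  le_upperDensity tendsto_const_nhds (.of_forall fun N => (densityIn_univ (hΦ.1 N)).ge)

lemma mem_progPreimage {E : Set Γ} {k : ℕ} {γ x : Γ} :
    x ∈ progPreimage E k γ ↔ ∀ i < k, x + i • γ ∈ E := by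
  simp [progPreimage]

lemma progPreimage_one (E : Set Γ) (γ : Γ) : progPreimage E 1 γ = E := by
  ext x
  simp [mem_progPreimage]

lemma abs_densityIn_add_sub_le (Q : Finset Γ) (E : Set Γ) (w : Γ) :
    |densityIn Q {x | x + w ∈ E} - densityIn Q E| ≤
      (((Q.image (· + w)) ∆ Q).card : ℝ) / (Q.card : ℝ) := by
  have hcard : (Q.filter (fun x => x ∈ {x | x + w ∈ E})).card =
      ((Q.image (· + w)).filter (fun x => x ∈ E)).card := by
    rw [Finset.filter_image, Finset.card_image_of_injective _ (add_left_injective w)]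
    rfl
  have key : ∀ A B : Finset Γ, ((A.filter (fun x => x ∈ E)).card : ℝ) ≤
      (B.filter (fun x => x ∈ E)).card + (A ∆ B).card := by
    intro A B
    norm_cast
    refine (Finset.card_le_card ?_).trans (Finset.card_union_le _ _)
    intro x
    simp only [Finset.mem_filter, Finset.mem_union, Finset.mem_symmDiff]
    tauto
  rw [densityIn, densityIn, ← sub_div, abs_div, Nat.abs_cast, hcard]
  gcongr
  rw [abs_le]
  have h₁ := key (Q.image (· + w)) Q
  have h₂ := key Q (Q.image (· + w))
  rw [symmDiff_comm] at h₂
  constructor <;> linarith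

/-- Some member of a Følner sequence realises the upper density of `E`, robustly under finitely many
translations, without exceeding the upper densities of finitely many return sets. -/
lemma IsFolner.exists_densityIn {Φ : ℕ → Finset Γ} (hΦ : IsFolner Φ) (E : Set Γ) (k : ℕ)
    (W : Finset Γ) {ε : ℝ} (hε : 0 < ε) :
    ∃ Q : Finset Γ, Q.Nonempty ∧ ∀ w ∈ W,
      upperDensity Φ E - ε ≤ densityIn Q {x | x + w ∈ E} ∧
      ∀ γ ∈ W, densityIn Q {x | x + w ∈ progPreimage E k γ} ≤
        upperDensity Φ (progPreimage E k γ) + ε := by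
  have hinv : ∀ᶠ N in atTop, ∀ w ∈ W,
      ((((Φ N).image (· + w)) ∆ (Φ N)).card : ℝ) / ((Φ N).card : ℝ) < ε / 2 :=
    (Filter.eventually_all_finset W).2 fun w _ => (hΦ.2 w).eventually_lt_const (half_pos hε)
  have hprog : ∀ᶠ N in atTop, ∀ γ ∈ W, densityIn (Φ N) (progPreimage E k γ) <
      upperDensity Φ (progPreimage E k γ) + ε / 2 :=
    (Filter.eventually_all_finset W).2 fun γ _ =>
      eventually_lt_of_limsup_lt (lt_add_of_pos_right _ (half_pos hε))
        (isBoundedUnder_densityIn Φ _)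
  have hE : ∃ᶠ N in atTop, upperDensity Φ E - ε / 2 < densityIn (Φ N) E :=
    frequently_lt_of_lt_limsup (isCoboundedUnder_densityIn Φ E)
      (sub_lt_self _ (half_pos hε))
  obtain ⟨N, hN, hN', hN''⟩ := (hE.and_eventually (hinv.and hprog)).exists
  refine ⟨Φ N, hΦ.1 N, fun w hw => ⟨?_, fun γ hγ => ?_⟩⟩
  · have h := (abs_le.1 (abs_densityIn_add_sub_le (Φ N) E w)).1
    linarith [hN' w hw]
  · have h := (abs_le.1 (abs_densityIn_add_sub_le (Φ N) (progPreimage E k γ) w)).2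
    linarith [hN' w hw, hN'' γ hγ]

lemma densityIn_product {α β : Type*} (I : Finset α) (V : Finset β) (P : Set (α × β)) :
    densityIn (I ×ˢ V) P = (∑ v ∈ V, densityIn I {i | (i, v) ∈ P}) / V.card := by
  simp only [densityIn, Finset.card_product, ← Finset.sum_div, Finset.card_filter,
    Finset.sum_product_right, Nat.cast_mul, Set.mem_ofPred_eq, Nat.cast_sum]
  rw [div_div]

lemma densityIn_product_le {α β : Type*} {I : Finset α} {V : Finset β} (hV : V.Nonempty)
    {P : Set (α × β)} {c : ℝ} (h : ∀ v ∈ V, densityIn I {i | (i, v) ∈ P} ≤ c) :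
    densityIn (I ×ˢ V) P ≤ c := by
  rw [densityIn_product, div_le_iff₀ (by exact_mod_cast hV.card_pos), mul_comm]
  simpa using Finset.sum_le_card_nsmul V _ c h

lemma le_densityIn_product {α β : Type*} {I : Finset α} {V : Finset β} (hV : V.Nonempty)
    {P : Set (α × β)} {c : ℝ} (h : ∀ v ∈ V, c ≤ densityIn I {i | (i, v) ∈ P}) :
    c ≤ densityIn (I ×ˢ V) P := by
  rw [densityIn_product, le_div_iff₀ (by exact_mod_cast hV.card_pos), mul_comm]
  simpa using Finset.card_nsmul_le_sum V _ c h

lemma densityIn_mixture {α β : Type*} {Q : Finset α} {R : Finset β} (hQ : Q.Nonempty)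
    (hR : R.Nonempty) {m n : ℕ} (hmn : m ≤ n) (hn : 0 < n) (A : Set α) (B : Set β) :
    densityIn (Q ×ˢ R ×ˢ Finset.range n) {i | if i.2.2 < m then i.1 ∈ A else i.2.1 ∈ B} =
      (m / n : ℝ) * densityIn Q A + (1 - m / n) * densityIn R B := by
  obtain ⟨l, rfl⟩ := Nat.exists_eq_add_of_le hmn
  have hQ' : (Q.card : ℝ) ≠ 0 := by exact_mod_cast hQ.card_pos.ne'
  have hR' : (R.card : ℝ) ≠ 0 := by exact_mod_cast hR.card_pos.ne'
  have hn' : (m + l : ℝ) ≠ 0 := by exact_mod_cast hn.ne'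
  have hm : ∀ x y, ∑ j ∈ Finset.range m,
      (if (if j < m then x ∈ A else y ∈ B) then 1 else 0) = m * if x ∈ A then 1 else 0 := by
    intro x y
    rw [Finset.sum_congr rfl (g := fun _ => if x ∈ A then 1 else 0)]
    · simp
    · intro j hj
      simp [Finset.mem_range.1 hj]
  simp only [densityIn, Finset.card_filter, Finset.sum_product, Finset.sum_range_add,
    Set.mem_ofPred_eq, hm, Finset.sum_add_distrib, Finset.sum_const, smul_eq_mul,
    Nat.not_lt.2 (Nat.le_add_right _ _), if_false, Finset.card_range, ← Finset.mul_sum,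
    Finset.card_product]
  push_cast
  field_simp
  ring

end Density

/-! ### Assembling Følner sequences in `F_p^ω` from cosets of finite subgroups -/

section Assembling

variable {p : ℕ} [NeZero p]

/-- The finite subgroup of `F_p^ω` of elements supported in `{0, …, N - 1}`. -/
def initialSubgroup (p : ℕ) [NeZero p] (N : ℕ) : Finset (Fpω p) :=
  (Finset.range N).finsupp fun _ => Finset.univ

lemma mem_initialSubgroup {N : ℕ} {v : Fpω p} :
    v ∈ initialSubgroup p N ↔ ∀ n, N ≤ n → v n = 0 := by
  simp only [initialSubgroup, Finset.mem_finsupp_iff, Finset.mem_univ, implies_true, and_true,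
    Finset.subset_iff, Finsupp.mem_support_iff, Finset.mem_range]
  refine forall_congr' fun n => ?_
  rw [← not_lt]
  tauto

lemma initialSubgroup_nonempty (N : ℕ) : (initialSubgroup p N).Nonempty :=
  ⟨0, mem_initialSubgroup.2 fun _ _ => rfl⟩

lemma add_mem_initialSubgroup {N : ℕ} {v w : Fpω p} (hv : v ∈ initialSubgroup p N)
    (hw : w ∈ initialSubgroup p N) : v + w ∈ initialSubgroup p N := by
  rw [mem_initialSubgroup] at *
  intro n hn
  simp [hv n hn, hw n hn]

lemma nsmul_mem_initialSubgroup {N : ℕ} {v : Fpω p} (hv : v ∈ initialSubgroup p N) (i : ℕ) :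
    i • v ∈ initialSubgroup p N := by
  rw [mem_initialSubgroup] at *
  intro n hn
  simp [hv n hn]

lemma eventually_mem_initialSubgroup (v : Fpω p) :
    ∀ᶠ N in atTop, v ∈ initialSubgroup p N := by
  obtain ⟨M, hM⟩ := v.support.bddAbove
  filter_upwards [eventually_gt_atTop M] with N hN
  refine mem_initialSubgroup.2 fun n hn => ?_
  by_contra h
  exact absurd (hM (Finsupp.mem_support_iff.2 h)) (by omega)

variable [Fact (1 < p)] {ι : Type*} [Encodable ι]

/-- A representative of a coset of `initialSubgroup p N`; distinct `(N, i)` give disjoint cosets. -/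
def cosetRep (p N : ℕ) (i : ι) : Fpω p :=
  Finsupp.single (Nat.pair N (Encodable.encode i)) 1

lemma add_cosetRep_inj {N N' : ℕ} {i i' : ι} {v v' : Fpω p}
    (hv : v ∈ initialSubgroup p N) (hv' : v' ∈ initialSubgroup p N')
    (h : v + cosetRep p N i = v' + cosetRep p N' i') : N = N' ∧ i = i' ∧ v = v' := by
  rw [mem_initialSubgroup] at hv hv'
  have hN : N ≤ Nat.pair N (Encodable.encode i) := Nat.left_le_pair _ _
  have hN' : N' ≤ Nat.pair N' (Encodable.encode i') := Nat.left_le_pair _ _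
  by_cases hg : Nat.pair N (Encodable.encode i) = Nat.pair N' (Encodable.encode i')
  · obtain ⟨rfl, hi⟩ := Nat.pair_eq_pair.1 hg
    obtain rfl := Encodable.encode_injective hi
    exact ⟨rfl, rfl, add_right_cancel h⟩
  · exfalso
    rcases le_or_gt N' (Nat.pair N (Encodable.encode i)) with hle | hlt
    · simpa [cosetRep, hv _ hN, hv' _ hle, Finsupp.single_apply, Ne.symm hg] using
        DFunLike.congr_fun h (Nat.pair N (Encodable.encode i))
    · simpa [cosetRep, hv _ ((hN.trans_lt hlt).le.trans hN'), hv' _ hN', Finsupp.single_apply,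
        hg] using DFunLike.congr_fun h (Nat.pair N' (Encodable.encode i'))

/-- Any array of subsets of the subgroups `initialSubgroup p N` can be assembled into a subset `E`
of `F_p^ω`, the `N`-th row being placed in disjoint cosets that form the `N`-th set of a Følner
sequence. -/
lemma exists_folner_assembling (I : ℕ → Finset ι) (hI : ∀ N, (I N).Nonempty)
    (B : ℕ → ι → Set (Fpω p)) :
    ∃ (Φ : ℕ → Finset (Fpω p)) (E : Set (Fpω p)), IsFolner Φ ∧
      ∀ N, ∀ γ ∈ initialSubgroup p N, ∀ k, densityIn (Φ N) (progPreimage E k γ) =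
        densityIn (I N ×ˢ initialSubgroup p N) {q | q.2 ∈ progPreimage (B N q.1) k γ} := by
  set f : ℕ → ι × Fpω p → Fpω p := fun N q => q.2 + cosetRep p N q.1 with hf
  set E : Set (Fpω p) := {w | ∃ N i, ∃ v ∈ initialSubgroup p N, v ∈ B N i ∧
    w = v + cosetRep p N i} with hE
  have mem_E : ∀ N i, ∀ v ∈ initialSubgroup p N, (v + cosetRep p N i ∈ E ↔ v ∈ B N i) := by
    intro N i v hv
    refine ⟨?_, fun h => ⟨N, i, v, hv, h, rfl⟩⟩
    rintro ⟨N', i', v', hv', hB, heq⟩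
    obtain ⟨rfl, rfl, rfl⟩ := add_cosetRep_inj hv hv' heq
    exact hB
  have hinj : ∀ N, Set.InjOn (f N) (I N ×ˢ initialSubgroup p N : Finset (ι × Fpω p)) := by
    rintro N ⟨i, v⟩ hq ⟨i', v'⟩ hq' heq
    rw [Finset.mem_coe, Finset.mem_product] at hq hq'
    obtain ⟨-, rfl, rfl⟩ := add_cosetRep_inj hq.2 hq'.2 heq
    rfl
  refine ⟨fun N => (I N ×ˢ initialSubgroup p N).image (f N), E,
    isFolner_of_eventually_add_mem
      (fun N => ((hI N).product (initialSubgroup_nonempty N)).image _) fun a => ?_, ?_⟩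
  · filter_upwards [eventually_mem_initialSubgroup a] with N ha w hw
    simp only [Finset.mem_image, Finset.mem_product, Prod.exists, hf] at hw ⊢
    obtain ⟨i, v, ⟨hi, hv⟩, rfl⟩ := hw
    exact ⟨i, v + a, ⟨hi, add_mem_initialSubgroup hv ha⟩, add_right_comm _ _ _⟩
  · intro N γ hγ k
    rw [densityIn_image (hinj N)]
    refine densityIn_congr fun ⟨i, v⟩ hq => ?_
    have hv := (Finset.mem_product.1 hq).2
    simp only [hf, Set.mem_preimage, Set.mem_ofPred_eq, mem_progPreimage]
    refine forall₂_congr fun j _ => ?_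
    rw [add_right_comm]
    exact mem_E N i _ (add_mem_initialSubgroup hv (nsmul_mem_initialSubgroup hγ j))

end Assembling

lemma exists_isFolner (p : ℕ) [NeZero p] [Fact (1 < p)] : ∃ Φ : ℕ → Finset (Fpω p), IsFolner Φ :=
  let ⟨Φ, _, hΦ, _⟩ := exists_folner_assembling (fun _ => {()}) (by simp) fun _ _ => ∅
  ⟨Φ, hΦ⟩

lemma closedUnderMixing_density (p : ℕ) [NeZero p] [Fact (1 < p)] (k : ℕ) :
    ClosedUnderMixing
      (fun q : {Φ : ℕ → Finset (Fpω p) // IsFolner Φ} × Set (Fpω p) => upperDensity q.1.1 q.2)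
      (fun q γ => upperDensity q.1.1 (progPreimage q.2 k γ)) := by
  rintro ⟨⟨Φ₁, hΦ₁⟩, E₁⟩ ⟨⟨Φ₂, hΦ₂⟩, E₂⟩ φ ψ a b ha hb hab
  have : Encodable (Fpω p) := Encodable.ofCountable _
  have hε : ∀ N : ℕ, (0 : ℝ) < 1 / ((N : ℝ) + 1) := fun N => by positivity
  choose Q hQ hQd using fun N : ℕ =>
    hΦ₁.exists_densityIn E₁ k ((initialSubgroup p N).image φ) (hε N)
  choose R hR hRd using fun N : ℕ =>
    hΦ₂.exists_densityIn E₂ k ((initialSubgroup p N).image ψ) (hε N)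
  set m : ℕ → ℕ := fun N => ⌈a * ((N + 1 : ℕ) : ℝ)⌉₊ with hm
  set I : ℕ → Finset (Fpω p × Fpω p × ℕ) := fun N => Q N ×ˢ R N ×ˢ Finset.range (N + 1) with hI
  set B : ℕ → Fpω p × Fpω p × ℕ → Set (Fpω p) := fun N i =>
    {v | if i.2.2 < m N then i.1 + φ v ∈ E₁ else i.2.1 + ψ v ∈ E₂} with hB
  obtain ⟨Φ, E, hΦ, hE⟩ := exists_folner_assembling I
    (fun N => (hQ N).product ((hR N).product (by simp))) B
  have hmN : ∀ N, m N ≤ N + 1 := by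
    intro N
    refine Nat.ceil_le.2 (mul_le_of_le_one_left (by positivity) (by linarith))
  set w : ℕ → ℝ := fun N => (m N : ℝ) / ((N + 1 : ℕ) : ℝ) with hw
  have hw0 : ∀ N, 0 ≤ w N := fun N => by positivity
  have hw1 : ∀ N, 0 ≤ 1 - w N := fun N =>
    sub_nonneg.2 (div_le_one_of_le₀ (by exact_mod_cast hmN N) (by positivity))
  have hw_lim : Tendsto w atTop (𝓝 a) :=
    (tendsto_nat_ceil_mul_div_atTop ha).comp
      (tendsto_natCast_atTop_atTop.comp (tendsto_add_atTop_nat 1))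
  have hw_lim' : Tendsto (fun N => 1 - w N) atTop (𝓝 b) := by
    rw [← hab]
    simpa using hw_lim.const_sub (a + b)
  have hε_lim : Tendsto (fun N : ℕ => 1 / ((N : ℝ) + 1)) atTop (𝓝 0) :=
    tendsto_one_div_add_atTop_nhds_zero_nat
  have hslice : ∀ N v γ j, densityIn (I N) {i | v ∈ progPreimage (B N i) j γ} =
      w N * densityIn (Q N) {x | x + φ v ∈ progPreimage E₁ j (φ γ)} +
        (1 - w N) * densityIn (R N) {x | x + ψ v ∈ progPreimage E₂ j (ψ γ)} := by
    intro N v γ j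
    rw [← densityIn_mixture (hQ N) (hR N) (hmN N) N.succ_pos]
    refine densityIn_congr fun i _ => ?_
    simp only [hB, Set.mem_ofPred_eq, mem_progPreimage, map_add, map_nsmul, add_assoc]
    split_ifs <;> rfl
  refine ⟨⟨⟨Φ, hΦ⟩, E⟩, ?_, fun γ => ?_⟩
  · have hlim : Tendsto (fun N : ℕ => w N * (upperDensity Φ₁ E₁ - 1 / ((N : ℝ) + 1)) +
        (1 - w N) * (upperDensity Φ₂ E₂ - 1 / ((N : ℝ) + 1))) atTop
        (𝓝 (a * (upperDensity Φ₁ E₁ - 0) + b * (upperDensity Φ₂ E₂ - 0))) :=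
      (hw_lim.mul (hε_lim.const_sub _)).add (hw_lim'.mul (hε_lim.const_sub _))
    rw [sub_zero, sub_zero] at hlim
    refine le_upperDensity hlim (.of_forall fun N => ?_)
    have h0 : (0 : Fpω p) ∈ initialSubgroup p N := mem_initialSubgroup.2 fun _ _ => rfl
    rw [← progPreimage_one E 0, hE N 0 h0 1]
    refine le_densityIn_product (initialSubgroup_nonempty N) fun v hv => ?_
    refine le_of_le_of_eq ?_ (hslice N v 0 1).symm
    simp only [progPreimage_one]
    exact add_le_add
      (mul_le_mul_of_nonneg_left (hQd N _ (Finset.mem_image_of_mem φ hv)).1 (hw0 N))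
      (mul_le_mul_of_nonneg_left (hRd N _ (Finset.mem_image_of_mem ψ hv)).1 (hw1 N))
  · have hlim : Tendsto (fun N : ℕ =>
        w N * (upperDensity Φ₁ (progPreimage E₁ k (φ γ)) + 1 / ((N : ℝ) + 1)) +
        (1 - w N) * (upperDensity Φ₂ (progPreimage E₂ k (ψ γ)) + 1 / ((N : ℝ) + 1))) atTop
        (𝓝 (a * (upperDensity Φ₁ (progPreimage E₁ k (φ γ)) + 0) +
          b * (upperDensity Φ₂ (progPreimage E₂ k (ψ γ)) + 0))) :=
      (hw_lim.mul (hε_lim.const_add _)).add (hw_lim'.mul (hε_lim.const_add _))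
    rw [add_zero, add_zero] at hlim
    refine upperDensity_le hlim ?_
    filter_upwards [eventually_mem_initialSubgroup γ] with N hγ
    rw [hE N γ hγ k]
    refine densityIn_product_le (initialSubgroup_nonempty N) fun v hv => ?_
    refine (hslice N v γ k).trans_le ?_
    exact add_le_add
      (mul_le_mul_of_nonneg_left ((hQd N _ (Finset.mem_image_of_mem φ hv)).2 _
        (Finset.mem_image_of_mem φ hγ)) (hw0 N))
      (mul_le_mul_of_nonneg_left ((hRd N _ (Finset.mem_image_of_mem ψ hv)).2 _
        (Finset.mem_image_of_mem ψ hγ)) (hw1 N))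

lemma exists_addMonoidHom_single (p : ℕ) (γseq : ℕ → Fpω p) :
    ∃ φ : Fpω p →+ Fpω p, ∀ n, φ (Finsupp.single n 1) = γseq n :=
  ⟨(Finsupp.linearCombination (ZMod p) γseq).toAddMonoidHom, fun n => by simp⟩

/-- **Convexity of the constants**: for a fixed prime `p` and integer `k ≥ 1`, each of
`δ ↦ c_IP^rec(k,δ,F_p^ω)`, `δ ↦ c_IP(k,δ,F_p^ω)`, `δ ↦ c^rec(k,δ,F_p^ω)` and
`δ ↦ c(k,δ,F_p^ω)` is convex on `[0,1]`. -/
theorem constants_convex (p : ℕ) (hp : p.Prime) (k : ℕ) (hk : 1 ≤ k) :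
    ConvexOn ℝ (Set.Icc (0 : ℝ) 1) (fun δ => cIPRec (Fpω p) k δ) ∧
    ConvexOn ℝ (Set.Icc (0 : ℝ) 1) (fun δ => cIP (Fpω p) k δ) ∧
    ConvexOn ℝ (Set.Icc (0 : ℝ) 1) (fun δ => cRec (Fpω p) k δ) ∧
    ConvexOn ℝ (Set.Icc (0 : ℝ) 1) (fun δ => cF (Fpω p) k δ) := by
  have : NeZero p := ⟨hp.ne_zero⟩
  have : Fact (1 < p) := ⟨hp.one_lt⟩
  have hrec := closedUnderMixing_rec (Γ := Fpω p) k
  have hrec0 : ∀ (q : Σ S : GSystem (Fpω p), {A : Set S.X // MeasurableSet A}) (γ : Fpω p),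
      0 ≤ (q.1.μ (recIntersection q.1 q.2.1 k γ)).toReal := fun _ _ => ENNReal.toReal_nonneg
  have hrec1 : ∀ (q : Σ S : GSystem (Fpω p), {A : Set S.X // MeasurableSet A}) (γ : Fpω p),
      (q.1.μ (recIntersection q.1 q.2.1 k γ)).toReal ≤ 1 := fun q _ =>
    measureReal_le_one (μ := q.1.μ)
  have hrec_one : ∃ q : Σ S : GSystem (Fpω p), {A : Set S.X // MeasurableSet A},
      1 ≤ (q.1.μ q.2.1).toReal := by
    obtain ⟨S⟩ := nonempty_gSystem (Fpω p)
    exact ⟨⟨S, Set.univ, .univ⟩, by simp⟩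
  have hden := closedUnderMixing_density p k
  have hden0 : ∀ (q : {Φ : ℕ → Finset (Fpω p) // IsFolner Φ} × Set (Fpω p)) (γ : Fpω p),
      0 ≤ upperDensity q.1.1 (progPreimage q.2 k γ) := fun _ _ => upperDensity_nonneg _ _
  have hden1 : ∀ (q : {Φ : ℕ → Finset (Fpω p) // IsFolner Φ} × Set (Fpω p)) (γ : Fpω p),
      upperDensity q.1.1 (progPreimage q.2 k γ) ≤ 1 := fun _ _ => upperDensity_le_one _ _
  have hden_one : ∃ q : {Φ : ℕ → Finset (Fpω p) // IsFolner Φ} × Set (Fpω p),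
      1 ≤ upperDensity q.1.1 q.2 := by
    obtain ⟨Φ, hΦ⟩ := exists_isFolner p
    exact ⟨⟨⟨Φ, hΦ⟩, Set.univ⟩, hΦ.upperDensity_univ⟩
  have he := exists_addMonoidHom_single p
  refine ⟨?_, ?_, ?_, ?_⟩
  · convert hrec.convexOn_sInf_sSup_IP hrec0 hrec1 hrec_one _ he using 2 with δ
    refine congrArg sInf (Set.ext fun r => ⟨?_, ?_⟩)
    · rintro ⟨S, A, hA, hδ, γseq, hr⟩
      exact ⟨⟨⟨S, A, hA⟩, γseq⟩, hδ, hr⟩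
    · rintro ⟨⟨⟨S, A, hA⟩, γseq⟩, hδ, hr⟩
      exact ⟨S, A, hA, hδ, γseq, hr⟩
  · convert hden.convexOn_sInf_sSup_IP hden0 hden1 hden_one _ he using 2 with δ
    refine congrArg sInf (Set.ext fun r => ⟨?_, ?_⟩)
    · rintro ⟨Φ, hΦ, E, hδ, γseq, hr⟩
      exact ⟨⟨⟨⟨Φ, hΦ⟩, E⟩, γseq⟩, hδ, hr⟩
    · rintro ⟨⟨⟨⟨Φ, hΦ⟩, E⟩, γseq⟩, hδ, hr⟩
      exact ⟨Φ, hΦ, E, hδ, γseq, hr⟩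
  · convert hrec.convexOn_sInf_sSup hrec0 hrec1 hrec_one using 2 with δ
    refine congrArg sInf (Set.ext fun r => ⟨?_, ?_⟩)
    · rintro ⟨S, A, hA, hδ, hr⟩
      exact ⟨⟨S, A, hA⟩, hδ, hr⟩
    · rintro ⟨⟨S, A, hA⟩, hδ, hr⟩
      exact ⟨S, A, hA, hδ, hr⟩
  · convert hden.convexOn_sInf_sSup hden0 hden1 hden_one using 2 with δ
    refine congrArg sInf (Set.ext fun r => ⟨?_, ?_⟩)
    · rintro ⟨Φ, hΦ, E, hδ, hr⟩
      exact ⟨⟨⟨Φ, hΦ⟩, E⟩, hδ, hr⟩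
    · rintro ⟨⟨⟨Φ, hΦ⟩, E⟩, hδ, hr⟩
      exact ⟨Φ, hΦ, E, hδ, hr⟩

end
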